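/- Let k be a field and C a k-linear abelian category. Let A be a simple object of C such that every endomorphism of A is a k-scalar multiple of the identity, and assume that every short exact sequence 0 → A → X → B → 0 in C in which B is a finite biproduct of copies of A splits. Let E be an object of C such that Hom(E, A) is a finite-dimensional k-vector space, of dimension m. Then there exists a short exact sequence 0 → F → E → A^{⊕m} → 0 in C with Hom(F, A) = 0. -/

import Mathlib

open CategoryTheory CategoryTheory.Limits

/-- A morphism `A^{⊕n} ⟶ A` precomposed with `biproduct.lift f` lies in the span of the
family `f`, provided all endomorphisms of `A` are scalars. -/
theorem biproduct_lift_comp_mem_span {k C : Type*} [Field k] [Category C] [Preadditive C]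
    [Linear k C] [HasFiniteBiproducts C] {A E : C}
    (hA : ∀ f : A ⟶ A, ∃ c : k, f = c • 𝟙 A) {n : ℕ} (f : Fin n → (E ⟶ A))
    (h : (⨁ fun _ : Fin n => A) ⟶ A) :
    biproduct.lift f ≫ h ∈ Submodule.span k (Set.range f) := by
  have hsum : biproduct.lift f ≫ h = ∑ j, f j ≫ biproduct.ι (fun _ : Fin n => A) j ≫ h := by
    rw [biproduct.lift_eq, Preadditive.sum_comp]
    simp only [Category.assoc]
  rw [hsum]
  refine Submodule.sum_mem _ fun j _ => ?_
  obtain ⟨c, hc⟩ := hA (biproduct.ι (fun _ : Fin n => A) j ≫ h)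
  rw [hc, Linear.comp_smul, Category.comp_id]
  exact Submodule.smul_mem _ _ (Submodule.subset_span ⟨j, rfl⟩)

/-- Linearly independent morphisms to a simple object with scalar endomorphisms assemble
to an epimorphism onto a biproduct of copies of it. -/
theorem epi_biproduct_lift_of_linearIndependent {k C : Type*} [Field k] [Category C] [Abelian C]
    [Linear k C] [HasFiniteBiproducts C] {A E : C} [Simple A]
    (hA : ∀ f : A ⟶ A, ∃ c : k, f = c • 𝟙 A) {n : ℕ} (f : Fin n → (E ⟶ A))
    (hf : LinearIndependent k f) : Epi (biproduct.lift f) := by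
  induction n with
  | zero =>
    refine Preadditive.epi_of_cancel_zero _ fun h _ => ?_
    ext j
    exact j.elim0
  | succ n ih =>
    rw [linearIndependent_finSucc] at hf
    obtain ⟨hli, hnot⟩ := hf
    have : Epi (biproduct.lift fun j : Fin n => f j.succ) := ih _ hli
    set p := biproduct.lift (fun j : Fin n => f j.succ) with hp
    have hι (j : Fin n) : kernel.ι p ≫ f j.succ = 0 := by
      have h : p ≫ biproduct.π (fun _ : Fin n => A) j = f j.succ := biproduct.lift_π _ _
      rw [← h, kernel.condition_assoc, zero_comp]
    have hne : kernel.ι p ≫ f 0 ≠ 0 := by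
      intro h0
      apply hnot
      rw [← Abelian.comp_epiDesc p (f 0) h0]
      exact biproduct_lift_comp_mem_span hA _ _
    have := epi_of_nonzero_to_simple hne
    refine Preadditive.epi_of_cancel_zero _ fun h hh => ?_
    rw [biproduct.lift_eq, Preadditive.sum_comp, Fin.sum_univ_succ] at hh
    simp only [Category.assoc] at hh
    have h0 : biproduct.ι (fun _ : Fin (n + 1) => A) 0 ≫ h = 0 := by
      rw [← cancel_epi (kernel.ι p ≫ f 0)]
      have := kernel.ι p ≫= hh
      simpa [Preadditive.comp_sum, reassoc_of% hι] using this
    have hs : biproduct.desc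
        (fun j : Fin n => biproduct.ι (fun _ : Fin (n + 1) => A) j.succ ≫ h) = 0 := by
      rw [← cancel_epi p, hp, biproduct.lift_desc, comp_zero]
      simpa [h0] using hh
    ext j
    refine Fin.cases (by simpa using h0) (fun i => ?_) j
    have := biproduct.ι (fun _ : Fin n => A) i ≫= hs
    simpa using this

/-- The pushout of a short exact sequence along a morphism out of its left term is short exact. -/
theorem shortExact_pushout {C : Type*} [Category C] [Abelian C] {F E B A : C}
    {i : F ⟶ E} {π : E ⟶ B} (w : i ≫ π = 0) (h : (ShortComplex.mk i π w).ShortExact)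
    (g : F ⟶ A) :
    (ShortComplex.mk (pushout.inr i g) (pushout.desc π (0 : A ⟶ B) (by simp [w]))
      (pushout.inr_desc _ _ _)).ShortExact := by
  have : Mono i := h.mono_f
  have : Epi π := h.epi_g
  have hepi : Epi (pushout.desc π (0 : A ⟶ B) (by simp [w]) : pushout i g ⟶ B) := by
    have : Epi (pushout.inl i g ≫ pushout.desc π (0 : A ⟶ B) (by simp [w])) := by
      rw [pushout.inl_desc]; infer_instance
    exact epi_of_epi (pushout.inl i g) _
  refine ShortComplex.ShortExact.mk' ?_ inferInstance hepi
  refine ShortComplex.exact_of_g_is_cokernel _ ?_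
  have key {Z : C} (t : pushout i g ⟶ Z) (ht : pushout.inr i g ≫ t = 0) :
      i ≫ pushout.inl i g ≫ t = 0 := by
    rw [pushout.condition_assoc, ht, comp_zero]
  refine CokernelCofork.IsColimit.ofπ' _ _ fun t ht =>
    ⟨h.exact.desc (pushout.inl i g ≫ t) (key t ht), ?_⟩
  apply pushout.hom_ext
  · rw [pushout.inl_desc_assoc]
    exact h.exact.g_desc _ _
  · rw [pushout.inr_desc_assoc, zero_comp]
    exact ht.symm

/-- Torsion-pair decomposition: if `A` is a simple object with scalar
endomorphisms such that every short exact sequence `0 → A → X → A^{⊕m} → 0`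
splits (encoding `Ext¹(A, A) = 0`), and `Hom(E, A)` is `m`-dimensional, then
there is a short exact sequence `0 → F → E → A^{⊕m} → 0` with `Hom(F, A) = 0`. -/
theorem stmt10 (k : Type*) [Field k] (C : Type*) [Category C] [Abelian C]
    [Linear k C] [HasFiniteBiproducts C] (A : C) [Simple A]
    (hA : ∀ f : A ⟶ A, ∃ c : k, f = c • 𝟙 A)
    (hsplit : ∀ (m : ℕ) (X : C) (i : A ⟶ X) (π : X ⟶ (⨁ fun _ : Fin m => A))
      (w : i ≫ π = 0), (ShortComplex.mk i π w).ShortExact →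
        ∃ r : X ⟶ A, i ≫ r = 𝟙 A)
    (E : C) [FiniteDimensional k (E ⟶ A)] (m : ℕ)
    (hm : m = Module.finrank k (E ⟶ A)) :
    ∃ (F : C) (ι : F ⟶ E) (π : E ⟶ (⨁ fun _ : Fin m => A)) (w : ι ≫ π = 0),
      (ShortComplex.mk ι π w).ShortExact ∧ ∀ g : F ⟶ A, g = 0 := by
  subst hm
  let b := Module.finBasis k (E ⟶ A)
  have : Epi (biproduct.lift b) :=
    epi_biproduct_lift_of_linearIndependent hA b b.linearIndependent
  have hex : (ShortComplex.mk (kernel.ι (biproduct.lift b)) (biproduct.lift b)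
      (kernel.condition _)).ShortExact :=
    ShortComplex.ShortExact.mk' (ShortComplex.exact_kernel _) inferInstance inferInstance
  refine ⟨_, _, _, _, hex, fun g => ?_⟩
  obtain ⟨r, hr⟩ := hsplit _ _ _ _ _ (shortExact_pushout _ hex g)
  have hb (j) : kernel.ι (biproduct.lift b) ≫ b j = 0 := by
    rw [← biproduct.lift_π b j, kernel.condition_assoc, zero_comp]
  calc g = g ≫ pushout.inr _ g ≫ r := by rw [hr, Category.comp_id]
    _ = kernel.ι (biproduct.lift b) ≫ pushout.inl _ g ≫ r := by
      rw [pushout.condition_assoc]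
    _ = 0 := by
      rw [← b.sum_repr (pushout.inl _ g ≫ r), Preadditive.comp_sum]
      simp [hb]
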